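/- arXiv:2602.14952 — 7 statements merged into one kernel-verified Lean document; each statement's English description precedes it below -/
import Mathlib

section
/- Fixed Share interval regret (Lemma 1). Assume 0 < η ≤ 1 and 0 < γ ≤ 1/2. Then for every interval I = [r,s] with 1 ≤ r ≤ s ≤ T, the Fixed Share weights satisfy Σ_{t=r}^{s} ⟨q^(t), ℓ^(t)⟩ ≥ max_{i∈L} Σ_{t=r}^{s} ℓ^(t)_i − η·(Σ_{t=r}^{s} ⟨q^(t), (ℓ^(t))²⟩) − (1/η)·(log(|L|/γ) + 2γ|I|). -/
/-- One step of the Fixed Share update keeps the weights summing to one and bounded below by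
the uniform share `γ / |L|`. -/
lemma fixed_share_update_mem {L : Type*} [Fintype L] [Nonempty L] {γ : ℝ}
    (hγ1 : γ ≤ 1) {p w p' : L → ℝ} (hp : ∀ i, 0 < p i) (hw : ∀ i, 0 < w i)
    (hp' : ∀ i, p' i = (1 - γ) * p i * w i / (∑ j, p j * w j) + γ / (Fintype.card L : ℝ)) :
    ∑ i, p' i = 1 ∧ ∀ i, γ / (Fintype.card L : ℝ) ≤ p' i := by
  have hZ : 0 < ∑ j, p j * w j :=
    Finset.sum_pos (fun j _ => mul_pos (hp j) (hw j)) Finset.univ_nonempty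
  have hcard : (0 : ℝ) < Fintype.card L := by exact_mod_cast Fintype.card_pos
  refine ⟨?_, fun i => ?_⟩
  · simp only [hp', Finset.sum_add_distrib, ← Finset.sum_div, mul_assoc, ← Finset.mul_sum,
      Finset.sum_const, Finset.card_univ, nsmul_eq_mul]
    field_simp
    ring
  · have := mul_nonneg (mul_nonneg (sub_nonneg.2 hγ1) (hp i).le) (hw i).le
    rw [hp' i]
    exact le_add_of_nonneg_left (div_nonneg this hZ.le)

/-- Second-order bound on the logarithm of the moment generating function of a bounded loss. -/
lemma log_sum_mul_exp_le {L : Type*} [Fintype L] [Nonempty L] {η : ℝ} (hη0 : 0 < η)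
    (hη1 : η ≤ 1) {p l : L → ℝ} (hp : ∀ i, 0 < p i) (hsum : ∑ i, p i = 1)
    (hl : ∀ i, l i ∈ Set.Icc (-1 : ℝ) 1) :
    Real.log (∑ i, p i * Real.exp (η * l i)) ≤
      η * (∑ i, p i * l i) + η ^ 2 * ∑ i, p i * (l i) ^ 2 := by
  have hZ : 0 < ∑ i, p i * Real.exp (η * l i) :=
    Finset.sum_pos (fun i _ => mul_pos (hp i) (Real.exp_pos _)) Finset.univ_nonempty
  have hexp (i : L) : Real.exp (η * l i) ≤ 1 + η * l i + (η * l i) ^ 2 := by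
    have habs : |η * l i| ≤ 1 := by
      rw [abs_mul, abs_of_pos hη0]
      exact mul_le_one₀ hη1 (abs_nonneg _) (abs_le.2 (hl i))
    linarith [(abs_le.1 (Real.abs_exp_sub_one_sub_id_le habs)).2]
  have hle : ∑ i, p i * Real.exp (η * l i) ≤
      1 + η * (∑ i, p i * l i) + η ^ 2 * ∑ i, p i * (l i) ^ 2 := by
    rw [← hsum, Finset.mul_sum, Finset.mul_sum, ← Finset.sum_add_distrib,
      ← Finset.sum_add_distrib]
    refine Finset.sum_le_sum fun i _ => ?_
    linarith [mul_le_mul_of_nonneg_left (hexp i) (hp i).le]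
  linarith [Real.log_le_sub_one_of_pos hZ]

/-- Lower bound on the growth of a log-weight in one step of the Fixed Share update. -/
lemma le_log_fixed_share_update {γ a x Z b c : ℝ} (hγ0 : 0 ≤ γ) (hγ2 : γ ≤ 1 / 2) (ha : 0 < a)
    (hZ : 0 < Z) (hc : 0 ≤ c) (hb : b = (1 - γ) * a * Real.exp x / Z + c) :
    Real.log a + x - Real.log Z - 2 * γ ≤ Real.log b := by
  have h1 : 0 < 1 - γ := by linarith
  have hlog : -(2 * γ) ≤ Real.log (1 - γ) := by
    have hinv : (1 - γ)⁻¹ ≤ 1 + 2 * γ := by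
      rw [inv_le_iff_one_le_mul₀ h1]
      nlinarith
    linarith [Real.one_sub_inv_le_log_of_pos h1]
  have hmono : Real.log ((1 - γ) * a * Real.exp x / Z) ≤ Real.log b :=
    Real.log_le_log (by positivity) (by linarith)
  rw [Real.log_div (by positivity) hZ.ne', Real.log_mul (by positivity) (Real.exp_ne_zero _),
    Real.log_mul h1.ne' ha.ne', Real.log_exp] at hmono
  linarith

/-- **Fixed Share interval regret (Lemma 1).**
Assume `0 < η ≤ 1` and `0 < γ ≤ 1/2`. Then for every interval `I = [r,s]` with
`1 ≤ r ≤ s ≤ T`, the Fixed Share weights satisfy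
`Σ_{t=r}^{s} ⟨q^(t), ℓ^(t)⟩ ≥ max_i Σ_{t=r}^{s} ℓ^(t)_i − η·Σ_{t=r}^{s} ⟨q^(t), (ℓ^(t))²⟩
  − (1/η)·(log(|L|/γ) + 2γ|I|)`. -/
theorem fixed_share_interval_regret
    {L : Type*} [Fintype L] [Nonempty L]
    (T : ℕ) (hT : 1 ≤ T)
    (ℓ : ℕ → L → ℝ)
    (hℓ : ∀ t ∈ Finset.Icc 1 T, ∀ i, ℓ t i ∈ Set.Icc (-1 : ℝ) 1)
    (η γ : ℝ) (hη0 : 0 < η) (hη1 : η ≤ 1) (hγ0 : 0 < γ) (hγ2 : γ ≤ 1 / 2)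
    (q : ℕ → L → ℝ)
    (hq1 : ∀ i, q 1 i = 1 / (Fintype.card L : ℝ))
    (hqrec : ∀ t ∈ Finset.Icc 1 T, ∀ i,
      q (t + 1) i = (1 - γ) * q t i * Real.exp (η * ℓ t i) /
          (∑ j, q t j * Real.exp (η * ℓ t j)) + γ / (Fintype.card L : ℝ))
    (r s : ℕ) (hr : 1 ≤ r) (hrs : r ≤ s) (hsT : s ≤ T) :
    ∑ t ∈ Finset.Icc r s, ∑ i, q t i * ℓ t i ≥
      (Finset.univ.sup' Finset.univ_nonempty fun i => ∑ t ∈ Finset.Icc r s, ℓ t i)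
        - η * (∑ t ∈ Finset.Icc r s, ∑ i, q t i * (ℓ t i) ^ 2)
        - (1 / η) * (Real.log ((Fintype.card L : ℝ) / γ) + 2 * γ * ((s : ℝ) - r + 1)) := by
  have hcard : (0 : ℝ) < Fintype.card L := by exact_mod_cast Fintype.card_pos
  have hshare : 0 < γ / (Fintype.card L : ℝ) := div_pos hγ0 hcard
  have hq : ∀ t, 1 ≤ t → t ≤ T + 1 →
      ∑ i, q t i = 1 ∧ ∀ i, γ / (Fintype.card L : ℝ) ≤ q t i := by
    intro t ht
    induction t, ht using Nat.le_induction with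
    | base =>
      intro _
      refine ⟨?_, fun i => ?_⟩
      · simp [hq1, hcard.ne']
      · rw [hq1]
        gcongr
        linarith
    | succ t ht ih =>
      intro htT
      exact fixed_share_update_mem (by linarith)
        (fun i => hshare.trans_le ((ih (by omega)).2 i)) (fun i => Real.exp_pos _)
        (hqrec t (Finset.mem_Icc.2 ⟨ht, by omega⟩))
  have hstep : ∀ i, ∀ t ∈ Finset.Icc r s,
      η * ℓ t i - η * (∑ j, q t j * ℓ t j) - η ^ 2 * (∑ j, q t j * (ℓ t j) ^ 2) - 2 * γ ≤
        Real.log (q (t + 1) i) - Real.log (q t i) := by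
    intro i t ht
    obtain ⟨hrt, hts⟩ := Finset.mem_Icc.1 ht
    have htT : t ∈ Finset.Icc 1 T := Finset.mem_Icc.2 ⟨by omega, by omega⟩
    obtain ⟨hsum, hge⟩ := hq t (by omega) (by omega)
    have hpos (j : L) : 0 < q t j := hshare.trans_le (hge j)
    have hZ : 0 < ∑ j, q t j * Real.exp (η * ℓ t j) :=
      Finset.sum_pos (fun j _ => mul_pos (hpos j) (Real.exp_pos _)) Finset.univ_nonempty
    have hgrow := le_log_fixed_share_update hγ0.le hγ2 (hpos i) hZ hshare.le (hqrec t htT i)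
    have hmgf := log_sum_mul_exp_le hη0 hη1 hpos hsum (hℓ t htT)
    linarith
  have hmain (i : L) : η * (∑ t ∈ Finset.Icc r s, ℓ t i) ≤
      η * (∑ t ∈ Finset.Icc r s, ∑ j, q t j * ℓ t j)
        + η ^ 2 * (∑ t ∈ Finset.Icc r s, ∑ j, q t j * (ℓ t j) ^ 2)
        + (Real.log ((Fintype.card L : ℝ) / γ) + 2 * γ * ((s : ℝ) - r + 1)) := by
    have htotal := Finset.sum_le_sum (hstep i)
    rw [← Finset.Ico_add_one_right_eq_Icc, Finset.sum_Ico_sub (fun t => Real.log (q t i))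
      (by omega : r ≤ s + 1), Finset.Ico_add_one_right_eq_Icc] at htotal
    simp only [Finset.sum_sub_distrib, ← Finset.mul_sum, Finset.sum_const, Nat.card_Icc,
      nsmul_eq_mul] at htotal
    rw [Nat.cast_sub (by omega : r ≤ s + 1)] at htotal
    push_cast at htotal
    obtain ⟨hsum, hge⟩ := hq (s + 1) (by omega) (by omega)
    have hend : Real.log (q (s + 1) i) ≤ 0 := by
      refine Real.log_nonpos (hshare.le.trans (hge i)) ?_
      rw [← hsum]
      exact Finset.single_le_sum (fun j _ => hshare.le.trans (hge j)) (Finset.mem_univ i)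
    have hstart : -Real.log ((Fintype.card L : ℝ) / γ) ≤ Real.log (q r i) := by
      rw [← Real.log_inv, inv_div]
      exact Real.log_le_log hshare ((hq r hr (by omega)).2 i)
    linarith
  rw [ge_iff_le, sub_le_iff_le_add, sub_le_iff_le_add]
  refine Finset.sup'_le _ _ fun i _ => ?_
  refine le_of_mul_le_mul_left ((hmain i).trans_eq ?_) hη0
  field_simp
  ring
end

section
/- Nonpositivity of the minimax mixture value (Lemma 2). Suppose that for every Borel probability measure Q on Y there exists p* ∈ Y with ∫_Y u_i(p*, y) dQ(y) ≤ 0 for every i ∈ L. Then the learner's minimax value is nonpositive: inf over Borel probability measures P on Y of sup_{y ∈ Y} ∫_Y u(p, y) dP(p) is at most 0; equivalently, for every ε > 0 there exists a Borel probability measure P on Y such that sup_{y ∈ Y} ∫_Y u(p, y) dP(p) ≤ ε. -/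
open MeasureTheory

/-- The finitely supported measure with masses `c k` at the points `x k`. -/
noncomputable def weightedDirac {κ X : Type*} [MeasurableSpace X] (t : Finset κ) (c : κ → ℝ)
    (x : κ → X) : Measure X :=
  ∑ k ∈ t, ENNReal.ofReal (c k) • Measure.dirac (x k)

theorem isProbabilityMeasure_weightedDirac {κ X : Type*} [MeasurableSpace X] {t : Finset κ}
    {c : κ → ℝ} (hc : ∀ k ∈ t, 0 ≤ c k) (hsum : ∑ k ∈ t, c k = 1) (x : κ → X) :
    IsProbabilityMeasure (weightedDirac t c x) := by
  constructor
  simp [weightedDirac, Measure.finsetSum_apply, ← ENNReal.ofReal_sum_of_nonneg hc, hsum]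

theorem integral_weightedDirac {κ X : Type*} [MeasurableSpace X] [MeasurableSingletonClass X]
    {t : Finset κ} {c : κ → ℝ} (hc : ∀ k ∈ t, 0 ≤ c k) (x : κ → X) (f : X → ℝ) :
    ∫ z, f z ∂weightedDirac t c x = ∑ k ∈ t, c k * f (x k) := by
  rw [weightedDirac, integral_finsetSum_measure]
  · refine Finset.sum_congr rfl fun k hk => ?_
    rw [integral_smul_measure, integral_dirac, ENNReal.toReal_ofReal (hc k hk), smul_eq_mul]
  · exact fun k _ => (integrable_dirac (by simp)).smul_measure ENNReal.ofReal_ne_top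

/-- A finite-dimensional theorem of the alternative: if every probability vector pairs
nonpositively with some point of a convex set, then the set has points all of whose coordinates
are arbitrarily close to being nonpositive. -/
theorem Convex.exists_forall_lt_of_forall_exists_sum_mul_nonpos {ι : Type*} [Fintype ι]
    {S : Set (ι → ℝ)} (hS : Convex ℝ S) (hne : S.Nonempty)
    (h : ∀ c : ι → ℝ, (∀ j, 0 ≤ c j) → ∑ j, c j = 1 → ∃ v ∈ S, ∑ j, c j * v j ≤ 0)
    {δ : ℝ} (hδ : 0 < δ) : ∃ v ∈ S, ∀ j, v j < δ := by
  classical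
  by_contra! hcon
  let T : Set (ι → ℝ) := Set.univ.pi fun _ => Set.Iio δ
  have hT : Convex ℝ T := convex_pi fun _ _ => convex_Iio δ
  have hTo : IsOpen T := isOpen_set_pi Set.finite_univ fun _ _ => isOpen_Iio
  have hdisj : Disjoint T S := by
    refine Set.disjoint_left.2 fun v hvT hvS => ?_
    obtain ⟨j, hj⟩ := hcon v hvS
    exact absurd (hvT j trivial) (not_lt.2 hj)
  obtain ⟨f, s, hfT, hfS⟩ := geometric_hahn_banach_open hT hTo hS hdisj
  let d : ι → ℝ := fun j => f (Pi.single j 1)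
  have hf (v : ι → ℝ) : f v = ∑ j, d j * v j := by
    conv_lhs => rw [pi_eq_sum_univ' v]
    simp [d, mul_comm]
  have hs : 0 < s := by
    simpa using hfT 0 fun _ _ => hδ
  have hd (j : ι) : 0 ≤ d j := by
    by_contra! hj
    have hmem : (s / d j) • (Pi.single j 1 : ι → ℝ) ∈ T := by
      intro k _
      by_cases hk : k = j
      · subst hk
        simpa using (div_neg_of_pos_of_neg hs hj).trans hδ
      · simpa [hk] using hδ
    have hlt := hfT _ hmem
    rw [map_smul, smul_eq_mul, div_mul_cancel₀ s hj.ne] at hlt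
    exact lt_irrefl _ hlt
  have hD : 0 < ∑ j, d j := by
    refine (Finset.sum_nonneg fun j _ => hd j).lt_of_ne fun h0 => ?_
    have hz := (Finset.sum_eq_zero_iff_of_nonneg fun j _ => hd j).1 h0.symm
    obtain ⟨v, hv⟩ := hne
    have hle := hfS v hv
    rw [hf, Finset.sum_eq_zero fun j hj => by rw [hz j hj, zero_mul]] at hle
    exact absurd hs (not_lt.2 hle)
  obtain ⟨v, hv, hle⟩ := h (fun j => d j / ∑ k, d k) (fun j => div_nonneg (hd j) hD.le)
    (by rw [← Finset.sum_div, div_self hD.ne'])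
  have hnonpos : (∑ j, d j * v j) / ∑ k, d k ≤ 0 := by
    simpa only [Finset.sum_div, div_mul_eq_mul_div] using hle
  have hpos : 0 < (∑ j, d j * v j) / ∑ k, d k :=
    div_pos (hs.trans_le (hf v ▸ hfS v hv)) hD
  exact absurd hpos (not_lt.2 hnonpos)

/-- A continuous function of two variables on a compact space admits a finite set of second
arguments that approximates every second argument, uniformly in the first. -/
theorem exists_finset_forall_lt_add {X : Type*} [PseudoMetricSpace X] [CompactSpace X]
    {w : X → X → ℝ} (hw : Continuous fun z : X × X => w z.1 z.2) {δ : ℝ} (hδ : 0 < δ) :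
    ∃ N : Finset X, ∀ y, ∃ y₀ ∈ N, ∀ p, w p y < w p y₀ + δ := by
  obtain ⟨η, hη, hclose⟩ := Metric.uniformContinuous_iff.1
    (CompactSpace.uniformContinuous_of_continuous hw) δ hδ
  obtain ⟨N, -, hN, hcov⟩ := (isCompact_univ (X := X)).finite_cover_balls hη
  refine ⟨hN.toFinset, fun y => ?_⟩
  obtain ⟨y₀, hy₀, hy⟩ := Set.mem_iUnion₂.1 (hcov (Set.mem_univ y))
  refine ⟨y₀, hN.mem_toFinset.2 hy₀, fun p => ?_⟩
  have hdist := hclose (a := (p, y)) (b := (p, y₀)) (by simpa [Prod.dist_eq, hη] using hy)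
  rw [Real.dist_eq] at hdist
  linarith [(abs_lt.1 hdist).2]

/-- One half of the minimax theorem for a continuous payoff on a compact space: if every mixed
outcome has a nonpositive response, some mixed response is almost nonpositive against every
outcome. -/
theorem exists_isProbabilityMeasure_forall_integral_le {X : Type*} [PseudoMetricSpace X]
    [CompactSpace X] [Nonempty X] [MeasurableSpace X] [MeasurableSingletonClass X]
    {w : X → X → ℝ} (hw : Continuous fun z : X × X => w z.1 z.2)
    (h : ∀ Q : Measure X, IsProbabilityMeasure Q → ∃ p, ∫ y, w p y ∂Q ≤ 0)
    {ε : ℝ} (hε : 0 < ε) :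
    ∃ P : Measure X, IsProbabilityMeasure P ∧ ∀ y, ∫ p, w p y ∂P ≤ ε := by
  obtain ⟨N, hN⟩ := exists_finset_forall_lt_add hw (half_pos hε)
  let g : X → N → ℝ := fun p y => w p y
  obtain ⟨v, hv, hvlt⟩ := (convex_convexHull ℝ (Set.range g)
    ).exists_forall_lt_of_forall_exists_sum_mul_nonpos (Set.range_nonempty g).convexHull
    (fun c hc hsum => by
      obtain ⟨p, hp⟩ := h (weightedDirac Finset.univ c (↑))
        (isProbabilityMeasure_weightedDirac (fun j _ => hc j) hsum _)
      rw [integral_weightedDirac fun j _ => hc j] at hp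
      exact ⟨g p, subset_convexHull ℝ _ ⟨p, rfl⟩, hp⟩) (half_pos hε)
  rw [convexHull_eq] at hv
  obtain ⟨κ, t, c, z, hc, hsum, hz, rfl⟩ := hv
  have : Nonempty κ := (Finset.nonempty_of_sum_ne_zero (hsum ▸ one_ne_zero)).to_type
  choose! x hx using hz
  refine ⟨weightedDirac t c x, isProbabilityMeasure_weightedDirac hc hsum x, fun y => ?_⟩
  obtain ⟨y₀, hy₀, hy⟩ := hN y
  rw [integral_weightedDirac hc]
  have hlt : ∑ k ∈ t, c k * w (x k) y₀ < ε / 2 := by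
    have hcoord := hvlt ⟨y₀, hy₀⟩
    rw [Finset.centerMass_eq_of_sum_1 _ _ hsum, Finset.sum_apply] at hcoord
    refine (Finset.sum_congr rfl fun k hk => ?_).trans_lt hcoord
    rw [← hx k hk]
    rfl
  calc ∑ k ∈ t, c k * w (x k) y
      ≤ ∑ k ∈ t, c k * (w (x k) y₀ + ε / 2) :=
        Finset.sum_le_sum fun k hk => mul_le_mul_of_nonneg_left (hy _).le (hc k hk)
    _ = ∑ k ∈ t, c k * w (x k) y₀ + ε / 2 := by
        simp_rw [mul_add, Finset.sum_add_distrib, ← Finset.sum_mul, hsum, one_mul]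
    _ ≤ ε := by linarith

/-- **Nonpositivity of the minimax mixture value (Lemma 2).**
Let `Y = [a,b]`, `u_i : Y × Y → [−1,1]` continuous, `q` a probability vector, and
`u(p,y) = Σ_i q_i · u_i(p,y)`. If for every Borel probability measure `Q` on `Y` there is
`p* ∈ Y` with `∫ u_i(p*,y) dQ(y) ≤ 0` for all `i`, then the learner's minimax value is
nonpositive: for every `ε > 0` there is a Borel probability measure `P` on `Y` with
`sup_{y ∈ Y} ∫ u(p,y) dP(p) ≤ ε`. -/
theorem minimax_mixture_value_nonpos
    {L : Type*} [Fintype L] [Nonempty L]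
    (a b : ℝ) (hab : a < b)
    (u : L → Set.Icc a b → Set.Icc a b → ℝ)
    (hu_cont : ∀ i, Continuous fun z : Set.Icc a b × Set.Icc a b => u i z.1 z.2)
    (hu_bdd : ∀ i p y, u i p y ∈ Set.Icc (-1 : ℝ) 1)
    (q : L → ℝ) (hq_nonneg : ∀ i, 0 ≤ q i) (hq_sum : ∑ i, q i = 1)
    (hbr : ∀ Q : Measure (Set.Icc a b), IsProbabilityMeasure Q →
      ∃ pstar : Set.Icc a b, ∀ i, (∫ y, u i pstar y ∂Q) ≤ 0) :
    ∀ ε > (0 : ℝ), ∃ P : Measure (Set.Icc a b), IsProbabilityMeasure P ∧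
      ∀ y : Set.Icc a b, (∫ p, (∑ i, q i * u i p y) ∂P) ≤ ε := by
  intro ε hε
  have : Nonempty (Set.Icc a b) := ⟨⟨a, Set.left_mem_Icc.2 hab.le⟩⟩
  refine exists_isProbabilityMeasure_forall_integral_le (w := fun p y => ∑ i, q i * u i p y)
    (continuous_finsetSum _ fun i _ => continuous_const.mul (hu_cont i)) (fun Q hQ => ?_) hε
  obtain ⟨p, hp⟩ := hbr Q hQ
  have hint (i : L) : Integrable (fun y => u i p y) Q := by
    have hcont : Continuous fun y => u i p y := (hu_cont i).comp (Continuous.prodMk_right p)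
    exact hcont.integrable_of_hasCompactSupport (HasCompactSupport.of_compactSpace _)
  refine ⟨p, ?_⟩
  rw [integral_finsetSum _ fun i _ => (hint i).const_mul (q i)]
  simp_rw [integral_const_mul]
  exact Finset.sum_nonpos fun i _ => mul_nonpos_of_nonneg_of_nonpos (hq_nonneg i) (hp i)
end

section
/- Locally adaptive multiaccurate mean estimation (Corollary 1). Let τ ≥ 1 be an integer, γ = 1/(2τ), and η = √((log((2|F|+1)·2τ) + 1)/τ), and assume η ≤ 1. Let q^(t) be the Fixed Share weights with parameters η, γ for the loss vectors ℓ^(t). Suppose that on every interval I = [r,s] ⊆ [T] of length |I| = τ the mixture losses are nonpositive: Σ_{t=r}^{s} ⟨q^(t), ℓ^(t)⟩ ≤ 0 (as holds when p_t(x_t) is chosen by the minimax program of Algorithm 3). Then for every interval I = [r,s] ⊆ [T] of length τ: max{ max_{f∈F, σ∈{±1}} (1/τ)·Σ_{t=r}^{s} σ·f(x_t)·(y_t − p_t), (1/τ)·Σ_{t=r}^{s} (c(p_t, y_t) − c(p̃_t, y_t)) } ≤ 2·√((log((2|F|+1)·2τ) + 1)/τ). -/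
/-- The Fixed Share update with learning rate `η` and share rate `γ`, run for the rounds `1, …, T`
from the uniform distribution on `ι`. -/
structure IsFixedShare {ι : Type*} [Fintype ι] (T : ℕ) (γ η : ℝ) (ℓ q : ℕ → ι → ℝ) : Prop where
  one_eq : ∀ i, q 1 i = 1 / (Fintype.card ι : ℝ)
  succ_eq : ∀ t ∈ Finset.Icc 1 T, ∀ i, q (t + 1) i =
    (1 - γ) * q t i * Real.exp (η * ℓ t i) / (∑ j, q t j * Real.exp (η * ℓ t j)) +
      γ / (Fintype.card ι : ℝ)

/-- A mixture of exponentials is bounded through the mixture of the exponents. -/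
theorem log_sum_mul_exp_le_s4 {ι : Type*} [Fintype ι] {η : ℝ} (hη : 0 ≤ η) (hη1 : η ≤ 1)
    {w v : ι → ℝ} (hw : ∀ i, 0 ≤ w i) (hw1 : ∑ i, w i = 1) (hv : ∀ i, |v i| ≤ 1) :
    Real.log (∑ i, w i * Real.exp (η * v i)) ≤ η * ∑ i, w i * v i + η ^ 2 := by
  have hterm : ∀ i, w i * Real.exp (η * v i) ≤ w i + η * (w i * v i) + w i * η ^ 2 := by
    intro i
    have habs : |η * v i| ≤ η := by
      rw [abs_mul, abs_of_nonneg hη]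
      exact mul_le_of_le_one_right hη (hv i)
    have hexp := (abs_le.mp (Real.abs_exp_sub_one_sub_id_le (habs.trans hη1))).2
    have hsq : (η * v i) ^ 2 ≤ η ^ 2 := sq_le_sq' (abs_le.mp habs).1 (abs_le.mp habs).2
    nlinarith [mul_le_mul_of_nonneg_left (hexp.trans hsq) (hw i)]
  have hsum := Finset.sum_le_sum fun i (_ : i ∈ Finset.univ) => hterm i
  rw [Finset.sum_add_distrib, Finset.sum_add_distrib, ← Finset.mul_sum, ← Finset.sum_mul,
    hw1, one_mul] at hsum
  have hpos : 0 < ∑ i, w i * Real.exp (η * v i) := by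
    have hnonneg : ∀ i ∈ Finset.univ, 0 ≤ w i * Real.exp (η * v i) :=
      fun i _ => mul_nonneg (hw i) (Real.exp_pos _).le
    obtain ⟨i, hi, hwi⟩ := Finset.exists_ne_zero_of_sum_ne_zero (hw1.trans_ne one_ne_zero)
    exact Finset.sum_pos' hnonneg
      ⟨i, hi, mul_pos ((hw i).lt_of_ne' hwi) (Real.exp_pos _)⟩
  linarith [Real.log_le_sub_one_of_pos hpos]

namespace IsFixedShare

variable {ι : Type*} [Fintype ι] [Nonempty ι] {T : ℕ} {γ η : ℝ} {ℓ q : ℕ → ι → ℝ}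

theorem share_le_and_sum_eq_one (h : IsFixedShare T γ η ℓ q) (hγ : 0 < γ) (hγ1 : γ ≤ 1) {t : ℕ}
    (ht : 1 ≤ t) : t ≤ T + 1 →
      (∀ i, γ / (Fintype.card ι : ℝ) ≤ q t i) ∧ ∑ i, q t i = 1 := by
  have hN : (0 : ℝ) < Fintype.card ι := by exact_mod_cast Fintype.card_pos
  induction t, ht using Nat.le_induction with
  | base =>
    refine fun _ => ⟨fun i => ?_, ?_⟩
    · rw [h.one_eq]
      gcongr
    · simp only [h.one_eq]
      simp [hN.ne']
  | succ t ht ih =>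
    intro htT
    obtain ⟨hlow, -⟩ := ih (by lia)
    have hq : ∀ i, 0 < q t i := fun i => (div_pos hγ hN).trans_le (hlow i)
    have hW : 0 < ∑ j, q t j * Real.exp (η * ℓ t j) :=
      Finset.sum_pos (fun j _ => mul_pos (hq j) (Real.exp_pos _)) Finset.univ_nonempty
    have hstep := h.succ_eq t (Finset.mem_Icc.mpr ⟨ht, by lia⟩)
    refine ⟨fun i => ?_, ?_⟩
    · rw [hstep]
      have hnum : 0 ≤ (1 - γ) * q t i * Real.exp (η * ℓ t i) :=
        mul_nonneg (mul_nonneg (by linarith) (hq i).le) (Real.exp_pos _).le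
      linarith [div_nonneg hnum hW.le]
    · simp only [hstep, mul_assoc]
      rw [Finset.sum_add_distrib, ← Finset.sum_div, ← Finset.mul_sum,
        mul_div_cancel_right₀ _ hW.ne', Finset.sum_const, Finset.card_univ, nsmul_eq_mul,
        mul_div_cancel₀ _ hN.ne']
      ring

theorem share_le (h : IsFixedShare T γ η ℓ q) (hγ : 0 < γ) (hγ1 : γ ≤ 1) {t : ℕ}
    (ht : 1 ≤ t) (htT : t ≤ T + 1) (i : ι) : γ / (Fintype.card ι : ℝ) ≤ q t i :=
  (h.share_le_and_sum_eq_one hγ hγ1 ht htT).1 i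

theorem sum_eq_one (h : IsFixedShare T γ η ℓ q) (hγ : 0 < γ) (hγ1 : γ ≤ 1) {t : ℕ}
    (ht : 1 ≤ t) (htT : t ≤ T + 1) : ∑ i, q t i = 1 :=
  (h.share_le_and_sum_eq_one hγ hγ1 ht htT).2

theorem pos (h : IsFixedShare T γ η ℓ q) (hγ : 0 < γ) (hγ1 : γ ≤ 1) {t : ℕ}
    (ht : 1 ≤ t) (htT : t ≤ T + 1) (i : ι) : 0 < q t i :=
  (div_pos hγ (by exact_mod_cast Fintype.card_pos)).trans_le (h.share_le hγ hγ1 ht htT i)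

theorem log_step (h : IsFixedShare T γ η ℓ q) (hγ : 0 < γ) (hγ1 : γ < 1) (hη : 0 ≤ η)
    (hη1 : η ≤ 1) (hℓ : ∀ t i, |ℓ t i| ≤ 1) {t : ℕ} (ht : 1 ≤ t) (htT : t ≤ T) (i : ι) :
    η * (ℓ t i - ∑ j, q t j * ℓ t j) ≤
      Real.log (q (t + 1) i) - Real.log (q t i) + (η ^ 2 - Real.log (1 - γ)) := by
  have hq := h.pos hγ hγ1.le ht (by lia)
  have hW : 0 < ∑ j, q t j * Real.exp (η * ℓ t j) :=
    Finset.sum_pos (fun j _ => mul_pos (hq j) (Real.exp_pos _)) Finset.univ_nonempty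
  have hγ' : 0 < 1 - γ := sub_pos.mpr hγ1
  have hnum : 0 < (1 - γ) * q t i := mul_pos hγ' (hq i)
  have hlog : Real.log ((1 - γ) * q t i * Real.exp (η * ℓ t i) /
      ∑ j, q t j * Real.exp (η * ℓ t j)) ≤ Real.log (q (t + 1) i) := by
    refine Real.log_le_log (div_pos (mul_pos hnum (Real.exp_pos _)) hW) ?_
    rw [h.succ_eq t (Finset.mem_Icc.mpr ⟨ht, htT⟩) i]
    exact le_add_of_nonneg_right (by positivity)
  rw [Real.log_div (mul_pos hnum (Real.exp_pos _)).ne' hW.ne',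
    Real.log_mul hnum.ne' (Real.exp_pos _).ne', Real.log_mul hγ'.ne' (hq i).ne',
    Real.log_exp] at hlog
  have hmix := log_sum_mul_exp_le_s4 hη hη1 (fun j => (hq j).le)
    (h.sum_eq_one hγ hγ1.le ht (by lia)) (hℓ t)
  linarith

/-- The adaptive regret bound of Fixed Share on the interval `[r, s]`. -/
theorem regret_le (h : IsFixedShare T γ η ℓ q) (hγ : 0 < γ) (hγ1 : γ < 1) (hη : 0 ≤ η)
    (hη1 : η ≤ 1) (hℓ : ∀ t i, |ℓ t i| ≤ 1) {r s : ℕ} (hr : 1 ≤ r) (hrs : r ≤ s) (hsT : s ≤ T)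
    (i : ι) :
    η * (∑ t ∈ Finset.Icc r s, ℓ t i - ∑ t ∈ Finset.Icc r s, ∑ j, q t j * ℓ t j) ≤
      Real.log (Fintype.card ι / γ) + ((s + 1 : ℕ) - r : ℝ) * (η ^ 2 - Real.log (1 - γ)) := by
  have hN : (0 : ℝ) < Fintype.card ι := by exact_mod_cast Fintype.card_pos
  have hstep : ∀ t ∈ Finset.Icc r s, η * (ℓ t i - ∑ j, q t j * ℓ t j) ≤
      Real.log (q (t + 1) i) - Real.log (q t i) + (η ^ 2 - Real.log (1 - γ)) := by
    intro t ht
    rw [Finset.mem_Icc] at ht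
    exact h.log_step hγ hγ1 hη hη1 hℓ (hr.trans ht.1) (ht.2.trans hsT) i
  have htel : ∑ t ∈ Finset.Icc r s, (Real.log (q (t + 1) i) - Real.log (q t i)) =
      Real.log (q (s + 1) i) - Real.log (q r i) := by
    rw [← Finset.Ico_add_one_right_eq_Icc,
      Finset.sum_Ico_sub (fun t => Real.log (q t i)) (by lia)]
  have hsum := Finset.sum_le_sum hstep
  rw [← Finset.mul_sum, Finset.sum_sub_distrib, Finset.sum_add_distrib, Finset.sum_const,
    Nat.card_Icc, nsmul_eq_mul, Nat.cast_sub (by lia), htel] at hsum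
  have hlast : Real.log (q (s + 1) i) ≤ 0 := by
    refine Real.log_nonpos (h.pos hγ hγ1.le (by lia) (by lia) i).le ?_
    rw [← h.sum_eq_one hγ hγ1.le (t := s + 1) (by lia) (by lia)]
    exact Finset.single_le_sum (f := q (s + 1))
      (fun j _ => (h.pos hγ hγ1.le (by lia) (by lia) j).le) (Finset.mem_univ i)
  have hfirst := Real.log_le_log (div_pos hγ hN) (h.share_le hγ hγ1.le hr (by lia) i)
  rw [← inv_div, Real.log_inv] at hfirst
  linarith

end IsFixedShare

theorem neg_mul_log_one_sub_half_inv_le_one {τ : ℝ} (hτ : 1 ≤ τ) :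
    -(τ * Real.log (1 - 1 / (2 * τ))) ≤ 1 := by
  have hpos : 0 < 1 - 1 / (2 * τ) := by
    rw [sub_pos, div_lt_one (by linarith)]
    linarith
  have hlog := Real.one_sub_inv_le_log_of_pos hpos
  have hinv : τ * (1 - (1 - 1 / (2 * τ))⁻¹) = -(τ / (2 * τ - 1)) := by
    have h1 : 2 * τ - 1 ≠ 0 := by linarith
    have h2 : 1 - 1 / (2 * τ) = (2 * τ - 1) / (2 * τ) := by field_simp
    rw [h2, inv_div, ← neg_div, eq_div_iff h1, mul_assoc, sub_mul, div_mul_cancel₀ _ h1]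
    ring
  have hle : τ / (2 * τ - 1) ≤ 1 := by
    rw [div_le_one (by linarith)]
    linarith
  nlinarith [mul_le_mul_of_nonneg_left hlog (by linarith : 0 ≤ τ)]

/-- With share rate `1 / (2 τ)` and the matching learning rate, nonpositive mixture losses on an
interval of length `τ` bound the average of every objective on it. -/
theorem IsFixedShare.average_le {ι : Type*} [Fintype ι] [Nonempty ι] {T τ : ℕ} {η : ℝ}
    {ℓ q : ℕ → ι → ℝ} (h : IsFixedShare T (1 / (2 * (τ : ℝ))) η ℓ q) (hτ : 1 ≤ τ)
    (hη : η = √((Real.log ((Fintype.card ι : ℝ) * (2 * (τ : ℝ))) + 1) / (τ : ℝ)))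
    (hη1 : η ≤ 1) (hℓ : ∀ t i, |ℓ t i| ≤ 1) {r s : ℕ} (hr : 1 ≤ r) (hrs : r ≤ s) (hsT : s ≤ T)
    (hlen : s + 1 = r + τ) (hmix : ∑ t ∈ Finset.Icc r s, ∑ i, q t i * ℓ t i ≤ 0) (i : ι) :
    (1 / (τ : ℝ)) * ∑ t ∈ Finset.Icc r s, ℓ t i ≤ 2 * η := by
  have hτ' : (1 : ℝ) ≤ τ := by exact_mod_cast hτ
  have hτ0 : (0 : ℝ) < τ := by linarith
  have hN : (1 : ℝ) ≤ Fintype.card ι := by exact_mod_cast Fintype.card_pos (α := ι)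
  have hlog : 0 ≤ Real.log ((Fintype.card ι : ℝ) * (2 * (τ : ℝ))) :=
    Real.log_nonneg (by nlinarith)
  have hη0 : 0 < η := by
    rw [hη]
    positivity
  have hηsq : (τ : ℝ) * η ^ 2 = Real.log ((Fintype.card ι : ℝ) * (2 * (τ : ℝ))) + 1 := by
    rw [hη, Real.sq_sqrt (by positivity)]
    field_simp
  have hγ1 : 1 / (2 * (τ : ℝ)) < 1 := by
    rw [div_lt_one (by linarith)]
    linarith
  have hreg := h.regret_le (by positivity) hγ1 hη0.le hη1 hℓ hr hrs hsT i
  rw [hlen, Nat.cast_add, add_sub_cancel_left, div_div_eq_mul_div, div_one] at hreg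
  have hshare := neg_mul_log_one_sub_half_inv_le_one hτ'
  have hηmix := mul_nonpos_of_nonneg_of_nonpos hη0.le hmix
  have hmain : η * ∑ t ∈ Finset.Icc r s, ℓ t i ≤ η * (2 * η * τ) := by nlinarith
  rw [one_div_mul_eq_div, div_le_iff₀ hτ0]
  exact le_of_mul_le_mul_left hmain hη0


/-- **Locally adaptive multiaccurate mean estimation (Corollary 1).**
Objectives are indexed by `Option (F × Bool)`: `some (f, σ)` is the multiaccuracy objective
`σ·f(x_t)·(y_t − p_t)` (with `σ = +1` for `true` and `−1` for `false`) and `none` is the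
prediction error objective `c(p_t,y_t) − c(p̃_t,y_t)`; the objective set has cardinality
`2|F|+1`. With `γ = 1/(2τ)`, `η = √((log((2|F|+1)·2τ)+1)/τ) ≤ 1`, Fixed Share weights `q`,
and mixture losses nonpositive on every length-`τ` interval, every interval
`I = [r,s] ⊆ [T]` of length `τ` satisfies
`max{ max_{f,σ} (1/τ)·Σ σ f(x_t)(y_t − p_t), (1/τ)·Σ (c(p_t,y_t) − c(p̃_t,y_t)) }
  ≤ 2·√((log((2|F|+1)·2τ)+1)/τ)`. -/
theorem locally_adaptive_multiaccurate_mean_estimation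
    {X : Type*} {F : Type*} [Fintype F] [Nonempty F]
    (fv : F → X → ℝ) (hfv : ∀ f x, fv f x ∈ Set.Icc (0 : ℝ) 1)
    (T : ℕ) (hT : 1 ≤ T)
    (x : ℕ → X) (y p ptil : ℕ → ℝ)
    (hy : ∀ t, y t ∈ Set.Icc (0 : ℝ) 1) (hp : ∀ t, p t ∈ Set.Icc (0 : ℝ) 1)
    (hptil : ∀ t, ptil t ∈ Set.Icc (0 : ℝ) 1)
    (c : ℝ → ℝ → ℝ)
    (hc : ∀ p' p'' y', p' ∈ Set.Icc (0 : ℝ) 1 → p'' ∈ Set.Icc (0 : ℝ) 1 →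
      y' ∈ Set.Icc (0 : ℝ) 1 → c p' y' - c p'' y' ∈ Set.Icc (-1 : ℝ) 1)
    (ℓ : ℕ → Option (F × Bool) → ℝ)
    (hℓMA : ∀ t (f : F) (σ : Bool),
      ℓ t (some (f, σ)) = (if σ then (1 : ℝ) else -1) * fv f (x t) * (y t - p t))
    (hℓpred : ∀ t, ℓ t none = c (p t) (y t) - c (ptil t) (y t))
    (τ : ℕ) (hτ : 1 ≤ τ)
    (γ η : ℝ)
    (hγdef : γ = 1 / (2 * (τ : ℝ)))
    (hηdef : η = Real.sqrt
      ((Real.log ((2 * (Fintype.card F : ℝ) + 1) * (2 * (τ : ℝ))) + 1) / (τ : ℝ)))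
    (hη1 : η ≤ 1)
    (q : ℕ → Option (F × Bool) → ℝ)
    (hq1 : ∀ i, q 1 i = 1 / (2 * (Fintype.card F : ℝ) + 1))
    (hqrec : ∀ t ∈ Finset.Icc 1 T, ∀ i,
      q (t + 1) i = (1 - γ) * q t i * Real.exp (η * ℓ t i) /
          (∑ j, q t j * Real.exp (η * ℓ t j)) + γ / (2 * (Fintype.card F : ℝ) + 1))
    (hmix : ∀ r s : ℕ, 1 ≤ r → r ≤ s → s ≤ T → s + 1 = r + τ →
      ∑ t ∈ Finset.Icc r s, ∑ i, q t i * ℓ t i ≤ 0)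
    (r s : ℕ) (hr : 1 ≤ r) (hrs : r ≤ s) (hsT : s ≤ T) (hlen : s + 1 = r + τ) :
    max
      (Finset.univ.sup' Finset.univ_nonempty fun fσ : F × Bool =>
        (1 / (τ : ℝ)) * ∑ t ∈ Finset.Icc r s,
          (if fσ.2 then (1 : ℝ) else -1) * fv fσ.1 (x t) * (y t - p t))
      ((1 / (τ : ℝ)) * ∑ t ∈ Finset.Icc r s, (c (p t) (y t) - c (ptil t) (y t)))
      ≤ 2 * Real.sqrt
          ((Real.log ((2 * (Fintype.card F : ℝ) + 1) * (2 * (τ : ℝ))) + 1) / (τ : ℝ)) := by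
  have hcard : (Fintype.card (Option (F × Bool)) : ℝ) = 2 * (Fintype.card F : ℝ) + 1 := by
    simp [mul_comm]
  have hFS : IsFixedShare T (1 / (2 * (τ : ℝ))) η ℓ q := by
    subst hγdef
    exact ⟨by rwa [hcard], by rwa [hcard]⟩
  have hℓ : ∀ t i, |ℓ t i| ≤ 1 := by
    rintro t (_ | ⟨f, σ⟩)
    · rw [hℓpred]
      exact abs_le.mpr (hc _ _ _ (hp t) (hptil t) (hy t))
    · have hsign : |if σ then (1 : ℝ) else -1| = 1 := by cases σ <;> simp
      have hf := hfv f (x t)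
      have hyp : |y t - p t| ≤ 1 :=
        abs_le.mpr ⟨by linarith [(hy t).1, (hp t).2], by linarith [(hy t).2, (hp t).1]⟩
      rw [hℓMA, abs_mul, abs_mul, hsign, one_mul, abs_of_nonneg hf.1]
      exact mul_le_one₀ hf.2 (abs_nonneg _) hyp
  have havg := hFS.average_le hτ (by rw [hcard, hηdef]) hη1 hℓ hr hrs hsT hlen
    (hmix r s hr hrs hsT hlen)
  rw [← hηdef]
  refine max_le (Finset.sup'_le _ _ fun fσ _ => ?_) ?_
  · simpa only [hℓMA] using havg (some fσ)
  · simpa only [hℓpred] using havg none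
end

section
/- Global multi-objective learning bound with Hedge (Theorem 2.1 of Lee et al., as used in the paper). Assume 0 < η ≤ 1 and suppose the mixture losses over the full horizon are nonpositive: Σ_{t=1}^{T} ⟨q^(t), ℓ^(t)⟩ ≤ 0 (as holds when each prediction is the learner's minimax-optimal response under the consistency assumption on the objectives). Then max_{i∈L} Σ_{t=1}^{T} ℓ^(t)_i ≤ log(|L|)/η + η·T. In particular, if additionally η = √(log(|L|)/T) ≤ 1, then max_{i∈L} Σ_{t=1}^{T} ℓ^(t)_i ≤ 2·√(T·log(|L|)). -/
/-- Exponential-moment bound for a probability vector `p` and losses `x` in `[-1, 1]`. -/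
theorem sum_mul_exp_le_exp {L : Type*} [Fintype L] {p x : L → ℝ} {η : ℝ}
    (hp : ∀ i, 0 ≤ p i) (hsum : ∑ i, p i = 1) (hx : ∀ i, x i ∈ Set.Icc (-1 : ℝ) 1)
    (hη0 : 0 ≤ η) (hη1 : η ≤ 1) :
    ∑ i, p i * Real.exp (η * x i) ≤ Real.exp (η * ∑ i, p i * x i + η ^ 2) := by
  have hexp (i : L) : Real.exp (η * x i) ≤ 1 + η * x i + η ^ 2 := by
    have hxi : |x i| ≤ 1 := abs_le.mpr (hx i)
    have habs : |η * x i| ≤ 1 := by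
      rw [abs_mul, abs_of_nonneg hη0]
      exact mul_le_one₀ hη1 (abs_nonneg _) hxi
    have h := (abs_le.mp (Real.abs_exp_sub_one_sub_id_le habs)).2
    have hsq : x i ^ 2 ≤ 1 := (sq_le_one_iff_abs_le_one _).mpr hxi
    nlinarith [mul_le_mul_of_nonneg_left hsq (sq_nonneg η)]
  calc ∑ i, p i * Real.exp (η * x i)
      ≤ ∑ i, p i * (1 + η * x i + η ^ 2) :=
        Finset.sum_le_sum fun i _ => mul_le_mul_of_nonneg_left (hexp i) (hp i)
    _ = (∑ i, p i) + η * ∑ i, p i * x i + (∑ i, p i) * η ^ 2 := by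
        rw [Finset.mul_sum, Finset.sum_mul, ← Finset.sum_add_distrib, ← Finset.sum_add_distrib]
        exact Finset.sum_congr rfl fun i _ => by ring
    _ = (η * ∑ i, p i * x i + η ^ 2) + 1 := by rw [hsum]; ring
    _ ≤ Real.exp (η * ∑ i, p i * x i + η ^ 2) := Real.add_one_le_exp _

/-- The Hedge weights remain a positive probability vector, and each weight dominates the
exponentiated cumulative loss of its coordinate relative to that of the mixture. -/
theorem hedge_weights_invariant {L : Type*} [Fintype L] [Nonempty L]
    {T : ℕ} {ℓ : ℕ → L → ℝ}
    (hℓ : ∀ t ∈ Finset.Icc 1 T, ∀ i, ℓ t i ∈ Set.Icc (-1 : ℝ) 1)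
    {η : ℝ} (hη0 : 0 ≤ η) (hη1 : η ≤ 1) {q : ℕ → L → ℝ}
    (hq1 : ∀ i, q 1 i = 1 / (Fintype.card L : ℝ))
    (hqrec : ∀ t ∈ Finset.Icc 1 T, ∀ i,
      q (t + 1) i = q t i * Real.exp (η * ℓ t i) / (∑ j, q t j * Real.exp (η * ℓ t j)))
    {n : ℕ} (hn : n ≤ T) :
    (∀ i, 0 < q (n + 1) i) ∧ ∑ i, q (n + 1) i = 1 ∧
      ∀ i, Real.exp (η * ∑ t ∈ Finset.Icc 1 n, ℓ t i) ≤
        Fintype.card L * q (n + 1) i *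
          Real.exp (η * ∑ t ∈ Finset.Icc 1 n, ∑ j, q t j * ℓ t j + n * η ^ 2) := by
  have hcard : (0 : ℝ) < Fintype.card L := by exact_mod_cast Fintype.card_pos
  induction n with
  | zero => simp [hq1, hcard, hcard.ne']
  | succ n ih =>
    obtain ⟨hpos, hsum, hdom⟩ := ih (by omega)
    have hmem : n + 1 ∈ Finset.Icc 1 T := Finset.mem_Icc.mpr ⟨by omega, hn⟩
    have hstep := hqrec _ hmem
    have hZle := sum_mul_exp_le_exp (fun i => (hpos i).le) hsum (hℓ _ hmem) hη0 hη1
    have hZ : 0 < ∑ j, q (n + 1) j * Real.exp (η * ℓ (n + 1) j) :=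
      Finset.sum_pos (fun i _ => mul_pos (hpos i) (Real.exp_pos _)) Finset.univ_nonempty
    set Z := ∑ j, q (n + 1) j * Real.exp (η * ℓ (n + 1) j) with hZdef
    have hpos' (i : L) : 0 < q (n + 1 + 1) i := by
      rw [hstep]
      exact div_pos (mul_pos (hpos i) (Real.exp_pos _)) hZ
    refine ⟨hpos', ?_, fun i => ?_⟩
    · simp_rw [hstep]
      rw [← Finset.sum_div, ← hZdef, div_self hZ.ne']
    · have hmul : q (n + 1) i * Real.exp (η * ℓ (n + 1) i) = q (n + 1 + 1) i * Z := by
        rw [hstep, div_mul_cancel₀ _ hZ.ne']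
      rw [Finset.sum_Icc_succ_top (by omega), Finset.sum_Icc_succ_top (by omega)]
      set S := ∑ t ∈ Finset.Icc 1 n, ∑ j, q t j * ℓ t j
      set m := ∑ j, q (n + 1) j * ℓ (n + 1) j
      calc Real.exp (η * (∑ t ∈ Finset.Icc 1 n, ℓ t i + ℓ (n + 1) i))
          = Real.exp (η * ∑ t ∈ Finset.Icc 1 n, ℓ t i) * Real.exp (η * ℓ (n + 1) i) := by
            rw [mul_add, Real.exp_add]
        _ ≤ Fintype.card L * q (n + 1) i * Real.exp (η * S + n * η ^ 2) *
              Real.exp (η * ℓ (n + 1) i) :=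
            mul_le_mul_of_nonneg_right (hdom i) (Real.exp_pos _).le
        _ = Fintype.card L * q (n + 1 + 1) i * Real.exp (η * S + n * η ^ 2) * Z := by
            linear_combination Fintype.card L * Real.exp (η * S + n * η ^ 2) * hmul
        _ ≤ Fintype.card L * q (n + 1 + 1) i * Real.exp (η * S + n * η ^ 2) *
              Real.exp (η * m + η ^ 2) :=
            mul_le_mul_of_nonneg_left hZle
              (mul_pos (mul_pos hcard (hpos' i)) (Real.exp_pos _)).le
        _ = Fintype.card L * q (n + 1 + 1) i *
              Real.exp (η * (S + m) + (n + 1 : ℕ) * η ^ 2) := by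
            rw [mul_assoc, ← Real.exp_add]
            push_cast
            ring_nf

/-- **Global multi-objective learning bound with Hedge (Theorem 2.1 of Lee et al.).**
Assume `0 < η ≤ 1` and that the mixture losses over the full horizon are nonpositive:
`Σ_{t=1}^{T} ⟨q^(t), ℓ^(t)⟩ ≤ 0`, where `q` are the Hedge weights. Then
`max_i Σ_{t=1}^{T} ℓ^(t)_i ≤ log(|L|)/η + η·T`; in particular, if additionally
`η = √(log(|L|)/T)`, then `max_i Σ_{t=1}^{T} ℓ^(t)_i ≤ 2·√(T·log(|L|))`. -/
theorem hedge_global_multiobjective_bound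
    {L : Type*} [Fintype L] [Nonempty L]
    (hcard : 2 ≤ Fintype.card L)
    (T : ℕ) (hT : 1 ≤ T)
    (ℓ : ℕ → L → ℝ)
    (hℓ : ∀ t ∈ Finset.Icc 1 T, ∀ i, ℓ t i ∈ Set.Icc (-1 : ℝ) 1)
    (η : ℝ) (hη0 : 0 < η) (hη1 : η ≤ 1)
    (q : ℕ → L → ℝ)
    (hq1 : ∀ i, q 1 i = 1 / (Fintype.card L : ℝ))
    (hqrec : ∀ t ∈ Finset.Icc 1 T, ∀ i,
      q (t + 1) i = q t i * Real.exp (η * ℓ t i) / (∑ j, q t j * Real.exp (η * ℓ t j)))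
    (hmix : ∑ t ∈ Finset.Icc 1 T, ∑ i, q t i * ℓ t i ≤ 0) :
    (Finset.univ.sup' Finset.univ_nonempty fun i => ∑ t ∈ Finset.Icc 1 T, ℓ t i)
        ≤ Real.log (Fintype.card L) / η + η * T ∧
    (η = Real.sqrt (Real.log (Fintype.card L) / T) →
      (Finset.univ.sup' Finset.univ_nonempty fun i => ∑ t ∈ Finset.Icc 1 T, ℓ t i)
        ≤ 2 * Real.sqrt (T * Real.log (Fintype.card L))) := by
  have hcard0 : (0 : ℝ) < Fintype.card L := by exact_mod_cast Fintype.card_pos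
  have hbound : (Finset.univ.sup' Finset.univ_nonempty fun i => ∑ t ∈ Finset.Icc 1 T, ℓ t i)
      ≤ Real.log (Fintype.card L) / η + η * T := by
    refine Finset.sup'_le _ _ fun i _ => ?_
    obtain ⟨hpos, hsum, hdom⟩ := hedge_weights_invariant hℓ hη0.le hη1 hq1 hqrec le_rfl
    have hqle : q (T + 1) i ≤ 1 :=
      hsum ▸ Finset.single_le_sum (fun j _ => (hpos j).le) (Finset.mem_univ i)
    have hexp : Real.exp (η * ∑ t ∈ Finset.Icc 1 T, ℓ t i) ≤
        Real.exp (Real.log (Fintype.card L) + T * η ^ 2) := by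
      rw [Real.exp_add, Real.exp_log hcard0]
      refine (hdom i).trans (mul_le_mul ?_ ?_ (Real.exp_pos _).le hcard0.le)
      · exact mul_le_of_le_one_right hcard0.le hqle
      · exact Real.exp_le_exp.mpr
          (add_le_of_nonpos_left (mul_nonpos_of_nonneg_of_nonpos hη0.le hmix))
    have hle := Real.exp_le_exp.mp hexp
    have hrhs : Real.log (Fintype.card L) / η + η * T =
        (Real.log (Fintype.card L) + T * η ^ 2) / η := by
      field_simp
    rw [hrhs, le_div_iff₀ hη0]
    linarith
  refine ⟨hbound, fun hη => hbound.trans_eq ?_⟩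
  have hT0 : (0 : ℝ) < T := by exact_mod_cast hT
  have hlog : 0 ≤ Real.log (Fintype.card L) :=
    Real.log_nonneg (by exact_mod_cast (by omega : 1 ≤ Fintype.card L))
  have hlog_eq : Real.log (Fintype.card L) = η ^ 2 * T := by
    rw [hη, Real.sq_sqrt (div_nonneg hlog hT0.le), div_mul_cancel₀ _ hT0.ne']
  have hsqrt : Real.sqrt (T * Real.log (Fintype.card L)) = η * T := by
    rw [hlog_eq, show (T : ℝ) * (η ^ 2 * T) = (η * T) ^ 2 by ring,
      Real.sqrt_sq (mul_pos hη0 hT0).le]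
  rw [hsqrt, hlog_eq]
  field_simp
  ring
end

section
/- Multicalibration error bounds multiaccuracy error: ℓ_MA ≤ m·ℓ_MC + 1/(2m). Precisely, sup_{f∈F, σ∈{±1}} (1/T)·Σ_{t=1}^{T} σ·f(x_t)·(y_t − p_t) ≤ m · sup_{f∈F, σ∈{±1}, 1≤j≤m} (1/T)·Σ_{t=1}^{T} σ·f(x_t)·1{p_t ∈ B_j}·(y_t − v_j) + 1/(2m). -/
open scoped Classical

/-- Indicator of membership in the `j`-th of `m` bins partitioning `[0,1]`:
`B_j = [(j−1)/m, j/m)` for `1 ≤ j ≤ m−1` and `B_m = [(m−1)/m, 1]`. -/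
noncomputable def binIndicator (m j : ℕ) (p : ℝ) : ℝ :=
  if ((j : ℝ) - 1) / m ≤ p ∧ (if j = m then p ≤ 1 else p < (j : ℝ) / m) then 1 else 0

/-- Every point of `[0,1]` lies in exactly one bin, at distance at most `1/(2m)` from its midpoint. -/
lemma exists_binIndicator_eq_ite (m : ℕ) (hm : 1 ≤ m) (p : ℝ) (hp : p ∈ Set.Icc (0 : ℝ) 1) :
    ∃ k ∈ Finset.Icc 1 m,
      (∀ j ∈ Finset.Icc 1 m, binIndicator m j p = if k = j then 1 else 0) ∧
      |p - (2 * (k : ℝ) - 1) / (2 * m)| ≤ 1 / (2 * (m : ℝ)) := by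
  have hm0 : (0 : ℝ) < m := by exact_mod_cast hm
  obtain ⟨hp0, hp1⟩ := hp
  obtain ⟨k, hk1, hkm, hlo, hhi, hlt⟩ : ∃ k : ℕ, 1 ≤ k ∧ k ≤ m ∧ (k : ℝ) - 1 ≤ p * m ∧
      p * m ≤ k ∧ (k ≠ m → p * m < k) := by
    rcases lt_or_ge (⌊p * m⌋₊ + 1) m with h | h
    · refine ⟨⌊p * m⌋₊ + 1, by omega, h.le, ?_, ?_, fun _ => ?_⟩ <;> push_cast
      · linarith [Nat.floor_le (mul_nonneg hp0 hm0.le)]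
      · exact (Nat.lt_floor_add_one _).le
      · exact Nat.lt_floor_add_one _
    · refine ⟨m, hm, le_rfl, ?_, by nlinarith, fun h => absurd rfl h⟩
      have h' : (m : ℝ) ≤ ⌊p * m⌋₊ + 1 := by exact_mod_cast h
      linarith [Nat.floor_le (mul_nonneg hp0 hm0.le)]
  refine ⟨k, Finset.mem_Icc.mpr ⟨hk1, hkm⟩, fun j hj => ?_, ?_⟩
  · obtain ⟨hj1, hjm⟩ := Finset.mem_Icc.mp hj
    unfold binIndicator
    refine if_congr ?_ rfl rfl
    rw [div_le_iff₀ hm0, lt_div_iff₀ hm0]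
    constructor
    · rintro ⟨h1, h2⟩
      rcases lt_trichotomy k j with h | h | h
      · have h' : (k : ℝ) + 1 ≤ j := by exact_mod_cast h
        linarith [hlt (by omega)]
      · exact h
      · have h' : (j : ℝ) + 1 ≤ k := by exact_mod_cast h
        rw [if_neg (by omega)] at h2
        linarith
    · rintro rfl
      refine ⟨hlo, ?_⟩
      split_ifs with h
      · exact hp1
      · exact hlt h
  · have h : p - (2 * (k : ℝ) - 1) / (2 * m) = (2 * (p * m) - (2 * k - 1)) / (2 * m) := by
      field_simp
    rw [h, abs_div, abs_of_pos (by positivity : (0 : ℝ) < 2 * m)]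
    gcongr
    rw [abs_le]
    constructor <;> linarith

/-- Replacing a prediction by the midpoint of its bin changes the error by at most `1/(2m)`. -/
lemma mul_sub_le_sum_binIndicator (m : ℕ) (hm : 1 ≤ m) (p : ℝ) (hp : p ∈ Set.Icc (0 : ℝ) 1)
    (c y : ℝ) (hc : |c| ≤ 1) :
    c * (y - p) ≤ ∑ j ∈ Finset.Icc 1 m,
      c * binIndicator m j p * (y - (2 * (j : ℝ) - 1) / (2 * m)) + 1 / (2 * (m : ℝ)) := by
  obtain ⟨k, hk, hind, habs⟩ := exists_binIndicator_eq_ite m hm p hp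
  have hsum : ∑ j ∈ Finset.Icc 1 m, c * binIndicator m j p * (y - (2 * (j : ℝ) - 1) / (2 * m)) =
      c * (y - (2 * (k : ℝ) - 1) / (2 * m)) := by
    rw [Finset.sum_eq_single_of_mem k hk]
    · rw [hind k hk, if_pos rfl, mul_one]
    · intro j hj hjk
      rw [hind j hj, if_neg hjk.symm, mul_zero, zero_mul]
  rw [hsum]
  have h := neg_le_abs (c * (p - (2 * (k : ℝ) - 1) / (2 * m)))
  rw [abs_mul] at h
  have h' := mul_le_of_le_one_left (abs_nonneg (p - (2 * (k : ℝ) - 1) / (2 * m))) hc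
  linarith

/-- **Multicalibration error bounds multiaccuracy error:** `ℓ_MA ≤ m·ℓ_MC + 1/(2m)`.
Precisely, `sup_{f,σ} (1/T)·Σ_t σ·f(x_t)·(y_t − p_t)
  ≤ m · sup_{f,σ,1≤j≤m} (1/T)·Σ_t σ·f(x_t)·1{p_t ∈ B_j}·(y_t − v_j) + 1/(2m)`,
with bin midpoints `v_j = (2j−1)/(2m)`. -/
theorem multicalibration_bounds_multiaccuracy
    {X : Type*} {F : Type*} [Fintype F] [Nonempty F]
    (fv : F → X → ℝ) (hfv : ∀ f x, fv f x ∈ Set.Icc (0 : ℝ) 1)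
    (m : ℕ) (hm : 1 ≤ m)
    (T : ℕ) (hT : 1 ≤ T)
    (x : ℕ → X) (y p : ℕ → ℝ)
    (hy : ∀ t, y t ∈ Set.Icc (0 : ℝ) 1) (hp : ∀ t, p t ∈ Set.Icc (0 : ℝ) 1) :
    (Finset.univ.sup' Finset.univ_nonempty fun fσ : F × Bool =>
      (1 / (T : ℝ)) * ∑ t ∈ Finset.Icc 1 T,
        (if fσ.2 then (1 : ℝ) else -1) * fv fσ.1 (x t) * (y t - p t))
    ≤ (m : ℝ) *
        (((Finset.univ : Finset (F × Bool)) ×ˢ Finset.Icc 1 m).sup'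
          (Finset.Nonempty.product Finset.univ_nonempty (Finset.nonempty_Icc.mpr hm))
          fun z : (F × Bool) × ℕ =>
            (1 / (T : ℝ)) * ∑ t ∈ Finset.Icc 1 T,
              (if z.1.2 then (1 : ℝ) else -1) * fv z.1.1 (x t) *
                binIndicator m z.2 (p t) *
                (y t - (2 * (z.2 : ℝ) - 1) / (2 * m)))
      + 1 / (2 * (m : ℝ)) := by
  have hT0 : (0 : ℝ) < T := by exact_mod_cast hT
  refine Finset.sup'_le _ _ fun fσ _ => ?_
  have hc : ∀ t, |(if fσ.2 then (1 : ℝ) else -1) * fv fσ.1 (x t)| ≤ 1 := fun t => by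
    obtain ⟨h0, h1⟩ := hfv fσ.1 (x t)
    rw [abs_mul, abs_of_nonneg h0]
    split_ifs <;> simpa using h1
  calc
    _ ≤ (1 / (T : ℝ)) * ∑ t ∈ Finset.Icc 1 T, (∑ j ∈ Finset.Icc 1 m,
          (if fσ.2 then (1 : ℝ) else -1) * fv fσ.1 (x t) * binIndicator m j (p t) *
            (y t - (2 * (j : ℝ) - 1) / (2 * m)) + 1 / (2 * (m : ℝ))) := by
      gcongr with t
      exact mul_sub_le_sum_binIndicator m hm (p t) (hp t) _ (y t) (hc t)
    _ = ∑ j ∈ Finset.Icc 1 m, (1 / (T : ℝ)) * ∑ t ∈ Finset.Icc 1 T,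
          (if fσ.2 then (1 : ℝ) else -1) * fv fσ.1 (x t) * binIndicator m j (p t) *
            (y t - (2 * (j : ℝ) - 1) / (2 * m)) + 1 / (2 * (m : ℝ)) := by
      rw [Finset.sum_add_distrib, mul_add, Finset.sum_comm, ← Finset.mul_sum, Finset.sum_const,
        Nat.card_Icc, Nat.add_sub_cancel, nsmul_eq_mul, ← mul_assoc (1 / (T : ℝ)) (T : ℝ),
        one_div_mul_cancel hT0.ne', one_mul]
    _ ≤ _ := by
      gcongr
      refine (Finset.sum_le_card_nsmul _ _ (Finset.sup' _ (Finset.univ_nonempty.product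
        (Finset.nonempty_Icc.mpr hm)) _) fun j hj => Finset.le_sup'
          (fun z : (F × Bool) × ℕ =>
            (1 / (T : ℝ)) * ∑ t ∈ Finset.Icc 1 T,
              (if z.1.2 then (1 : ℝ) else -1) * fv z.1.1 (x t) * binIndicator m z.2 (p t) *
                (y t - (2 * (z.2 : ℝ) - 1) / (2 * m)))
          (Finset.mk_mem_product (Finset.mem_univ fσ) hj)).trans_eq ?_
      rw [Nat.card_Icc, Nat.add_sub_cancel, nsmul_eq_mul]
end

section
/- Potential growth bound for the Fixed Share auxiliary weights. Assume 0 < η ≤ 1 and γ ∈ [0,1]. For each t let q^(t)_i = w^(t)_i / (Σ_{j∈L} w^(t)_j). Then for every 1 ≤ r ≤ s ≤ T: W^(s+1) / W^(r) ≤ exp( Σ_{t=r}^{s} ( η·⟨q^(t), ℓ^(t)⟩ + η²·⟨q^(t), (ℓ^(t))²⟩ ) ), where W^(t) = Σ_{j∈L} w^(t)_j, ⟨q,ℓ⟩ = Σ_i q_i·ℓ_i, and (ℓ)² is the entrywise square. -/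
/-- Mixing with the uniform distribution preserves total mass. -/
theorem sum_mix_uniform {L : Type*} [Fintype L] [Nonempty L] (γ : ℝ) (a : L → ℝ) :
    ∑ i, ((1 - γ) * a i + γ * (∑ j, a j) / (Fintype.card L : ℝ)) = ∑ j, a j := by
  have hcard : (Fintype.card L : ℝ) ≠ 0 := Nat.cast_ne_zero.mpr Fintype.card_ne_zero
  rw [Finset.sum_add_distrib, ← Finset.mul_sum, Finset.sum_const, Finset.card_univ, nsmul_eq_mul,
    mul_div_cancel₀ _ hcard]
  ring

/-- Second-order bound on the exponential moment of a bounded vector under the normalization of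
nonnegative weights. -/
theorem sum_mul_exp_le_sum_mul_exp {L : Type*} [Fintype L] {η : ℝ} (hη0 : 0 ≤ η) (hη1 : η ≤ 1)
    {w x : L → ℝ} (hw : ∀ i, 0 ≤ w i) (hW : 0 < ∑ j, w j)
    (hx : ∀ i, x i ∈ Set.Icc (-1 : ℝ) 1) :
    ∑ i, w i * Real.exp (η * x i) ≤
      (∑ j, w j) * Real.exp (η * ∑ i, (w i / ∑ j, w j) * x i
        + η ^ 2 * ∑ i, (w i / ∑ j, w j) * x i ^ 2) := by
  have hexp : ∀ i, Real.exp (η * x i) ≤ 1 + η * x i + (η * x i) ^ 2 := fun i => by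
    have h : |η * x i| ≤ 1 := by
      rw [abs_mul]
      exact mul_le_one₀ (by rwa [abs_of_nonneg hη0]) (abs_nonneg _) (abs_le.mpr (hx i))
    linarith [(abs_le.mp (Real.abs_exp_sub_one_sub_id_le h)).2]
  calc ∑ i, w i * Real.exp (η * x i)
      ≤ ∑ i, w i * (1 + η * x i + (η * x i) ^ 2) :=
        Finset.sum_le_sum fun i _ => mul_le_mul_of_nonneg_left (hexp i) (hw i)
    _ = (∑ j, w j) * (η * ∑ i, (w i / ∑ j, w j) * x i
        + η ^ 2 * ∑ i, (w i / ∑ j, w j) * x i ^ 2 + 1) := by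
        simp only [div_mul_eq_mul_div, ← Finset.sum_div]
        field_simp
        simp only [Finset.mul_sum, ← Finset.sum_add_distrib]
        exact Finset.sum_congr rfl fun i _ => by ring
    _ ≤ _ := mul_le_mul_of_nonneg_left (Real.add_one_le_exp _) hW.le

/-- **Potential growth bound for the Fixed Share auxiliary weights.**
With `w^(1)_i = 1`, `w^(t+1)_i = (1−γ)·w^(t)_i·exp(η·ℓ^(t)_i)
  + γ·(Σ_j w^(t)_j·exp(η·ℓ^(t)_j))/|L|`, `q^(t)_i = w^(t)_i / Σ_j w^(t)_j`, and
`W^(t) = Σ_j w^(t)_j`, for all `1 ≤ r ≤ s ≤ T`: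
`W^(s+1)/W^(r) ≤ exp( Σ_{t=r}^{s} (η·⟨q^(t),ℓ^(t)⟩ + η²·⟨q^(t),(ℓ^(t))²⟩) )`. -/
theorem fixed_share_potential_growth
    {L : Type*} [Fintype L] [Nonempty L]
    (T : ℕ) (hT : 1 ≤ T)
    (ℓ : ℕ → L → ℝ)
    (hℓ : ∀ t ∈ Finset.Icc 1 T, ∀ i, ℓ t i ∈ Set.Icc (-1 : ℝ) 1)
    (η γ : ℝ) (hη0 : 0 < η) (hη1 : η ≤ 1) (hγ : γ ∈ Set.Icc (0 : ℝ) 1)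
    (w : ℕ → L → ℝ)
    (hw1 : ∀ i, w 1 i = 1)
    (hwrec : ∀ t ∈ Finset.Icc 1 T, ∀ i,
      w (t + 1) i = (1 - γ) * w t i * Real.exp (η * ℓ t i) +
        γ * (∑ j, w t j * Real.exp (η * ℓ t j)) / (Fintype.card L : ℝ))
    (r s : ℕ) (hr : 1 ≤ r) (hrs : r ≤ s) (hsT : s ≤ T) :
    (∑ j, w (s + 1) j) / (∑ j, w r j) ≤
      Real.exp (∑ t ∈ Finset.Icc r s,
        (η * ∑ i, (w t i / ∑ j, w t j) * ℓ t i
          + η ^ 2 * ∑ i, (w t i / ∑ j, w t j) * (ℓ t i) ^ 2)) := by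
  have hsum : ∀ t ∈ Finset.Icc 1 T, ∑ i, w (t + 1) i = ∑ i, w t i * Real.exp (η * ℓ t i) := by
    intro t ht
    rw [← sum_mix_uniform γ fun i => w t i * Real.exp (η * ℓ t i)]
    exact Finset.sum_congr rfl fun i _ => by rw [hwrec t ht i, mul_assoc]
  have hpos : ∀ t, 1 ≤ t → t ≤ T + 1 → (∀ i, 0 ≤ w t i) ∧ 0 < ∑ j, w t j := by
    intro t ht
    induction t, ht using Nat.le_induction with
    | base => intro _; simp [hw1, Fintype.card_pos]
    | succ t ht ih =>
      intro htT
      obtain ⟨hw, hW⟩ := ih (by omega)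
      have hmem : t ∈ Finset.Icc 1 T := Finset.mem_Icc.mpr ⟨ht, by omega⟩
      have hexp : ∀ i, 0 ≤ w t i * Real.exp (η * ℓ t i) := fun i =>
        mul_nonneg (hw i) (Real.exp_pos _).le
      refine ⟨fun i => ?_, ?_⟩
      · rw [hwrec t hmem i, mul_assoc]
        exact add_nonneg (mul_nonneg (sub_nonneg.mpr hγ.2) (hexp i))
          (div_nonneg (mul_nonneg hγ.1 (Finset.sum_nonneg fun j _ => hexp j)) (Nat.cast_nonneg _))
      · rw [hsum t hmem]
        obtain ⟨i, hi, hwi⟩ := (Finset.sum_pos_iff_of_nonneg fun i _ => hw i).mp hW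
        exact Finset.sum_pos' (fun j _ => hexp j) ⟨i, hi, mul_pos hwi (Real.exp_pos _)⟩
  have hstep : ∀ t, 1 ≤ t → t ≤ T → ∑ j, w (t + 1) j ≤
      (∑ j, w t j) * Real.exp (η * ∑ i, (w t i / ∑ j, w t j) * ℓ t i
        + η ^ 2 * ∑ i, (w t i / ∑ j, w t j) * (ℓ t i) ^ 2) := by
    intro t ht htT
    have hmem : t ∈ Finset.Icc 1 T := Finset.mem_Icc.mpr ⟨ht, htT⟩
    obtain ⟨hw, hW⟩ := hpos t ht (by omega)
    rw [hsum t hmem]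
    exact sum_mul_exp_le_sum_mul_exp hη0.le hη1 hw hW (hℓ t hmem)
  rw [div_le_iff₀' (hpos r hr (by omega)).2]
  induction s, hrs using Nat.le_induction with
  | base => simpa using hstep r hr hsT
  | succ s hrs ih =>
    rw [Finset.sum_Icc_succ_top (by omega), Real.exp_add, ← mul_assoc]
    exact (hstep (s + 1) (by omega) hsT).trans
      (mul_le_mul_of_nonneg_right (ih (by omega)) (Real.exp_pos _).le)
end

section
/- Lower bounds on individual Fixed Share auxiliary weights. Assume η > 0 and γ ∈ [0,1). Then: (i) for every i ∈ L and every 1 ≤ r ≤ s ≤ T, w^(s+1)_i ≥ (1−γ)^{s−r+1} · w^(r)_i · exp( η·Σ_{t=r}^{s} ℓ^(t)_i ); and (ii) for every i ∈ L and every t with 2 ≤ t ≤ T+1, w^(t)_i ≥ (γ/|L|)·W^(t), where W^(t) = Σ_{j∈L} w^(t)_j. -/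
/-- **Lower bounds on individual Fixed Share auxiliary weights.**
Assume `η > 0` and `γ ∈ [0,1)`. Then:
(i) for every `i ∈ L` and `1 ≤ r ≤ s ≤ T`,
`w^(s+1)_i ≥ (1−γ)^{s−r+1} · w^(r)_i · exp(η·Σ_{t=r}^{s} ℓ^(t)_i)`; and
(ii) for every `i ∈ L` and every `t` with `2 ≤ t ≤ T+1`, `w^(t)_i ≥ (γ/|L|)·W^(t)`,
where `W^(t) = Σ_j w^(t)_j`. -/
theorem fixed_share_weight_lower_bounds
    {L : Type*} [Fintype L] [Nonempty L]
    (T : ℕ) (hT : 1 ≤ T)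
    (ℓ : ℕ → L → ℝ)
    (hℓ : ∀ t ∈ Finset.Icc 1 T, ∀ i, ℓ t i ∈ Set.Icc (-1 : ℝ) 1)
    (η γ : ℝ) (hη0 : 0 < η) (hγ0 : 0 ≤ γ) (hγ1 : γ < 1)
    (w : ℕ → L → ℝ)
    (hw1 : ∀ i, w 1 i = 1)
    (hwrec : ∀ t ∈ Finset.Icc 1 T, ∀ i,
      w (t + 1) i = (1 - γ) * w t i * Real.exp (η * ℓ t i) +
        γ * (∑ j, w t j * Real.exp (η * ℓ t j)) / (Fintype.card L : ℝ)) :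
    (∀ i : L, ∀ r s : ℕ, 1 ≤ r → r ≤ s → s ≤ T →
      w (s + 1) i ≥ (1 - γ) ^ (s - r + 1) * w r i *
        Real.exp (η * ∑ t ∈ Finset.Icc r s, ℓ t i)) ∧
    (∀ i : L, ∀ t : ℕ, 2 ≤ t → t ≤ T + 1 →
      w t i ≥ (γ / (Fintype.card L : ℝ)) * ∑ j, w t j) := by
  have hcard : (0 : ℝ) < Fintype.card L := by exact_mod_cast Fintype.card_pos
  have hγ : 0 ≤ 1 - γ := by linarith
  have hnonneg : ∀ t, 1 ≤ t → t ≤ T + 1 → ∀ i, 0 ≤ w t i := by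
    intro t ht
    induction t, ht using Nat.le_induction with
    | base => intro _ i; simp [hw1]
    | succ t ht ih =>
      intro htT i
      have hw := ih (by omega)
      have hsum : 0 ≤ ∑ j, w t j * Real.exp (η * ℓ t j) :=
        Finset.sum_nonneg fun j _ => mul_nonneg (hw j) (Real.exp_pos _).le
      have hwi := hw i
      rw [hwrec t (Finset.mem_Icc.2 ⟨ht, by omega⟩) i]
      positivity
  have hmix : ∀ t, 1 ≤ t → t ≤ T → 0 ≤ ∑ j, w t j * Real.exp (η * ℓ t j) :=
    fun t ht htT => Finset.sum_nonneg fun j _ =>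
      mul_nonneg (hnonneg t ht (by omega) j) (Real.exp_pos _).le
  have hstep : ∀ t, 1 ≤ t → t ≤ T → ∀ i,
      (1 - γ) * w t i * Real.exp (η * ℓ t i) ≤ w (t + 1) i := by
    intro t ht htT i
    rw [hwrec t (Finset.mem_Icc.2 ⟨ht, htT⟩) i]
    exact le_add_of_nonneg_right (div_nonneg (mul_nonneg hγ0 (hmix t ht htT)) hcard.le)
  refine ⟨?_, ?_⟩
  · intro i r s hr hrs
    induction s, hrs using Nat.le_induction with
    | base => intro hrT; simpa using hstep r hr hrT i
    | succ s hrs ih =>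
      intro hsT
      refine le_trans ?_ (hstep (s + 1) (by omega) hsT i)
      have hprev := ih (by omega)
      rw [Finset.sum_Icc_succ_top (by omega), mul_add, Real.exp_add,
        Nat.succ_sub hrs, Nat.succ_eq_add_one, pow_succ]
      calc _ = (1 - γ) * ((1 - γ) ^ (s - r + 1) * w r i *
              Real.exp (η * ∑ t ∈ Finset.Icc r s, ℓ t i)) * Real.exp (η * ℓ (s + 1) i) := by
            ring
        _ ≤ _ := by gcongr
  · intro i t ht htT
    obtain ⟨t, rfl⟩ : ∃ u, t = u + 1 := ⟨t - 1, by omega⟩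
    have hmem : t ∈ Finset.Icc 1 T := Finset.mem_Icc.2 ⟨by omega, by omega⟩
    have htotal : ∑ j, w (t + 1) j = ∑ j, w t j * Real.exp (η * ℓ t j) := by
      simp_rw [hwrec t hmem, Finset.sum_add_distrib, mul_assoc, ← Finset.mul_sum]
      rw [Finset.sum_const, Finset.card_univ, nsmul_eq_mul]
      field_simp
      ring
    rw [htotal, hwrec t hmem i, div_mul_eq_mul_div]
    have hwi := hnonneg t (by omega) (by omega) i
    exact le_add_of_nonneg_left (by positivity)
end
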